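/- arXiv:1012.1072 — 3 statements merged into one kernel-verified Lean document; each statement's English description precedes it below -/
import Mathlib

section
/- Hamiltonian identity (q017) for the reformulated elliptic Gaudin Hamiltonians: Let z_1,…,z_n ∈ ℂ satisfy z_a − z_c ∉ Γ_τ for all a ≠ c, fix a ∈ {1,…,n}, and let S^c = ∑_{γ∈Γ'_N} S^c_γ T_γ ∈ sl(N,ℂ). Define H_{1,c} = −(1/N) ∑_{b≠c} ⟨S^c φ̂_{z_c−z_b}(S^b)⟩ and H_0 = (1/2N) ∑_{c=1}^n ⟨S^c ℘̂(S^c)⟩ − (1/2N) ∑_{b≠c} ⟨S^b f̂_{z_b−z_c}(S^c)⟩. Then H_0 + ∑_{c≠a} E₁(z_a − z_c) H_{1,c} = (1/2N) ∑_{c=1}^n ⟨S^c ℘̂(S^c)⟩ + (1/N) ∑_{c≠a} ⟨S^a F̂_{z_a−z_c}(S^c)⟩ + (1/2N) ∑_{b,c: b≠a, c≠a, b≠c} ⟨S^c φ̂_{z_c−z_a}(φ̂_{z_a−z_b}(S^b))⟩. -/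
open scoped BigOperators
open Complex Matrix Finset

noncomputable section

/-- The lattice `Γ_τ = ℤ + τℤ`. -/
def latticeGamma (τ : ℂ) : Set ℂ := {w | ∃ m n : ℤ, w = (m : ℂ) + (n : ℂ) * τ}

/-- The odd theta function `ϑ(z|τ)`. -/
def theta (τ z : ℂ) : ℂ :=
  Complex.exp (2 * (Real.pi : ℂ) * Complex.I * τ / 8) *
    ∑' m : ℤ, (-1 : ℂ) ^ m *
      Complex.exp (2 * (Real.pi : ℂ) * Complex.I * ((m : ℂ) * ((m : ℂ) + 1) * τ / 2 + (m : ℂ) * z))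

/-- The first Eisenstein function `E₁(z) = ϑ'(z)/ϑ(z)`. -/
def E1 (τ z : ℂ) : ℂ := deriv (theta τ) z / theta τ z

/-- The second Eisenstein function `E₂(z) = −E₁'(z)`. -/
def E2 (τ z : ℂ) : ℂ := -deriv (E1 τ) z

/-- The constant `η₁` determined by `E₁(z) = 1/z − 2η₁z + O(z³)` near `z = 0`. -/
def eta1 (τ : ℂ) : ℂ :=
  -(deriv (fun z : ℂ => if z = 0 then 0 else E1 τ z - 1 / z) 0) / 2

/-- The Weierstrass function `℘(z) = E₂(z) − 2η₁`. -/
def wp (τ z : ℂ) : ℂ := E2 τ z - 2 * eta1 τ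

/-- The Kronecker function `φ(u,z) = ϑ(u+z)ϑ'(0)/(ϑ(u)ϑ(z))`. -/
def kronPhi (τ u z : ℂ) : ℂ := theta τ (u + z) * deriv (theta τ) 0 / (theta τ u * theta τ z)

/-- `f(u,z) = ∂_u φ(u,z)`. -/
def kronF (τ u z : ℂ) : ℂ := deriv (fun u' => kronPhi τ u' z) u

/-- `e_N(z) = exp(2πiz/N)`. -/
def eN (N : ℕ) (z : ℂ) : ℂ := Complex.exp (2 * (Real.pi : ℂ) * Complex.I * z / N)

/-- The matrix `Q = diag(e_N(1),…,e_N(N−1),1)`. -/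
def Qm (N : ℕ) : Matrix (Fin N) (Fin N) ℂ :=
  Matrix.diagonal fun i => eN N ((i : ℕ) + 1)

/-- The cyclic shift matrix `Λ`. -/
def Lm (N : ℕ) : Matrix (Fin N) (Fin N) ℂ :=
  Matrix.of fun i j => if ((i : ℕ) + 1) % N = (j : ℕ) then 1 else 0

/-- The basis matrices `T_γ = e_N(γ₁γ₂/2) Q^{γ₁} Λ^{γ₂}` for `γ ∈ ℤ²`. -/
def Tm (N : ℕ) (γ : ℤ × ℤ) : Matrix (Fin N) (Fin N) ℂ :=
  eN N (((γ.1 * γ.2 : ℤ) : ℂ) / 2) • (Qm N ^ γ.1 * Lm N ^ γ.2)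

/-- `ω_γ = (γ₁ + γ₂τ)/N`. -/
def om (N : ℕ) (τ : ℂ) (γ : ℤ × ℤ) : ℂ := ((γ.1 : ℂ) + (γ.2 : ℂ) * τ) / N

/-- `φ_γ(z) = e_N(γ₂z) φ(ω_γ, z)`. -/
def phiG (N : ℕ) (τ : ℂ) (γ : ℤ × ℤ) (z : ℂ) : ℂ := eN N ((γ.2 : ℂ) * z) * kronPhi τ (om N τ γ) z

/-- `f_γ(z) = e_N(γ₂z) f(ω_γ, z)`. -/
def fG (N : ℕ) (τ : ℂ) (γ : ℤ × ℤ) (z : ℂ) : ℂ := eN N ((γ.2 : ℂ) * z) * kronF τ (om N τ γ) z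

/-- `F_γ(z) = φ_γ(z)E₁(z) − f_γ(z)`. -/
def FG (N : ℕ) (τ : ℂ) (γ : ℤ × ℤ) (z : ℂ) : ℂ := phiG N τ γ z * E1 τ z - fG N τ γ z

/-- A fixed set of representatives of the nonzero classes of `(ℤ/Nℤ)²`. -/
def GammaN' (N : ℕ) : Finset (ℤ × ℤ) :=
  ((Finset.range N ×ˢ Finset.range N).image fun p => ((p.1 : ℤ), (p.2 : ℤ))) \ {(0, 0)}


/-- The matrix `S^c = ∑_{γ∈Γ'_N} S^c_γ T_γ`. -/
def SmatC (N : ℕ) {n : ℕ} (S : Fin n → (ℤ × ℤ) → ℂ) (c : Fin n) :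
    Matrix (Fin N) (Fin N) ℂ :=
  ∑ γ ∈ GammaN' N, S c γ • Tm N γ

/-- `φ̂_w(S^c)`. -/
def phiHatC (N : ℕ) (τ : ℂ) {n : ℕ} (S : Fin n → (ℤ × ℤ) → ℂ) (w : ℂ) (c : Fin n) :
    Matrix (Fin N) (Fin N) ℂ :=
  ∑ γ ∈ GammaN' N, (S c γ * phiG N τ γ w) • Tm N γ

/-- `f̂_w(S^c)`. -/
def fHatC (N : ℕ) (τ : ℂ) {n : ℕ} (S : Fin n → (ℤ × ℤ) → ℂ) (w : ℂ) (c : Fin n) :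
    Matrix (Fin N) (Fin N) ℂ :=
  ∑ γ ∈ GammaN' N, (S c γ * fG N τ γ w) • Tm N γ

/-- `F̂_w(S^c)`. -/
def FHatC (N : ℕ) (τ : ℂ) {n : ℕ} (S : Fin n → (ℤ × ℤ) → ℂ) (w : ℂ) (c : Fin n) :
    Matrix (Fin N) (Fin N) ℂ :=
  ∑ γ ∈ GammaN' N, (S c γ * FG N τ γ w) • Tm N γ

/-- `℘̂(S^c)`. -/
def wpHatC (N : ℕ) (τ : ℂ) {n : ℕ} (S : Fin n → (ℤ × ℤ) → ℂ) (c : Fin n) :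
    Matrix (Fin N) (Fin N) ℂ :=
  ∑ γ ∈ GammaN' N, (S c γ * wp τ (om N τ γ)) • Tm N γ

/-- `φ̂_{z_c−z_a}(φ̂_{z_a−z_b}(S^b))`. -/
def phiPhiHatC (N : ℕ) (τ : ℂ) {n : ℕ} (z : Fin n → ℂ) (S : Fin n → (ℤ × ℤ) → ℂ)
    (a b c : Fin n) : Matrix (Fin N) (Fin N) ℂ :=
  ∑ γ ∈ GammaN' N, (S b γ * phiG N τ γ (z a - z b) * phiG N τ γ (z c - z a)) • Tm N γ


/-! ### The symmetric theta function -/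

/-- The genuinely odd theta function `e^{πiz} ϑ(z)`. -/
def Th (τ z : ℂ) : ℂ := Complex.exp ((Real.pi : ℂ) * Complex.I * z) * theta τ z

lemma neg_cexp (x : ℂ) : - Complex.exp x = Complex.exp (x + (Real.pi : ℂ) * Complex.I) := by
  rw [Complex.exp_add, Complex.exp_pi_mul_I, mul_neg_one]

lemma theta_eq (τ z : ℂ) : theta τ z = Complex.exp (2 * (Real.pi : ℂ) * Complex.I * τ / 8) *
    jacobiTheta₂ (z + (1 + τ) / 2) τ := by
  unfold theta jacobiTheta₂
  congr 1
  refine tsum_congr fun m => ?_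
  rw [← Complex.exp_pi_mul_I, ← Complex.exp_int_mul, ← Complex.exp_add, jacobiTheta₂_term]
  congr 1
  ring

lemma theta_diff {τ : ℂ} (hτ : 0 < τ.im) : Differentiable ℂ (theta τ) := by
  have : theta τ = fun z => Complex.exp (2 * (Real.pi : ℂ) * Complex.I * τ / 8) *
    jacobiTheta₂ (z + (1 + τ) / 2) τ := funext (theta_eq τ)
  rw [this]
  intro z
  refine DifferentiableAt.const_mul ?_ _
  exact (differentiableAt_jacobiTheta₂_fst (z + (1 + τ) / 2) hτ).comp z
    (differentiableAt_id.add_const _)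

lemma Th_diff {τ : ℂ} (hτ : 0 < τ.im) : Differentiable ℂ (Th τ) := by
  unfold Th
  have := theta_diff hτ
  fun_prop

lemma theta_add_one (τ z : ℂ) : theta τ (z + 1) = theta τ z := by
  rw [theta_eq, theta_eq, ← jacobiTheta₂_add_left (z + (1 + τ) / 2)]
  ring_nf

lemma Th_add_one (τ z : ℂ) : Th τ (z + 1) = - Th τ z := by
  unfold Th
  rw [theta_add_one, mul_add, Complex.exp_add, mul_one, Complex.exp_pi_mul_I]
  ring

lemma Th_add_tau (τ z : ℂ) :
    Th τ (z + τ) = - (Complex.exp (-((Real.pi : ℂ) * Complex.I * (τ + 2 * z))) * Th τ z) := by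
  unfold Th
  rw [theta_eq, theta_eq, show z + τ + (1 + τ) / 2 = (z + (1 + τ) / 2) + τ by ring,
    jacobiTheta₂_add_left']
  have h : Complex.exp ((Real.pi : ℂ) * Complex.I * (z + τ)) *
      Complex.exp (-(Real.pi : ℂ) * Complex.I * (τ + 2 * (z + (1 + τ) / 2))) =
      - (Complex.exp (-((Real.pi : ℂ) * Complex.I * (τ + 2 * z))) *
        Complex.exp ((Real.pi : ℂ) * Complex.I * z)) := by
    rw [← Complex.exp_add, ← Complex.exp_add, neg_cexp,
      Complex.exp_eq_exp_iff_exists_int]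
    refine ⟨-1, ?_⟩
    push_cast
    ring
  linear_combination (Complex.exp (2 * (Real.pi : ℂ) * Complex.I * τ / 8) *
    jacobiTheta₂ (z + (1 + τ) / 2) τ) * h

lemma Th_neg (τ z : ℂ) : Th τ (-z) = - Th τ z := by
  have h1 : jacobiTheta₂ (-z + (1 + τ) / 2) τ = jacobiTheta₂ (z + (-1 - τ) / 2) τ := by
    rw [← jacobiTheta₂_neg_left]; congr 1; ring
  have h2 : jacobiTheta₂ (z + (1 + τ) / 2) τ =
      Complex.exp (-(Real.pi : ℂ) * Complex.I * (τ + 2 * (z + (1 - τ) / 2))) *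
        jacobiTheta₂ (z + (-1 - τ) / 2) τ := by
    rw [show z + (1 + τ) / 2 = (z + (1 - τ) / 2) + τ by ring, jacobiTheta₂_add_left',
      show z + (1 - τ) / 2 = (z + (-1 - τ) / 2) + 1 by ring, jacobiTheta₂_add_left]
  unfold Th
  rw [theta_eq, theta_eq, h1, h2]
  have h : Complex.exp ((Real.pi : ℂ) * Complex.I * (-z)) =
      - (Complex.exp ((Real.pi : ℂ) * Complex.I * z) *
      Complex.exp (-(Real.pi : ℂ) * Complex.I * (τ + 2 * (z + (1 - τ) / 2)))) := by
    rw [← Complex.exp_add, neg_cexp,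
      Complex.exp_eq_exp_iff_exists_int]
    refine ⟨0, ?_⟩
    push_cast
    ring
  rw [h]
  ring

/-- The parity decomposition of `ℤ × ℤ`. -/
def parMap : (ℤ × ℤ) ⊕ (ℤ × ℤ) → ℤ × ℤ
  | .inl p => (p.1 + p.2, p.1 - p.2)
  | .inr p => (p.1 + p.2 + 1, p.1 - p.2)

lemma parMap_bij : Function.Bijective parMap := by
  constructor
  · rintro (⟨a, b⟩ | ⟨a, b⟩) (⟨c, d⟩ | ⟨c, d⟩) h <;> simp only [parMap, Prod.mk.injEq] at h
    · have h1 : a = c := by omega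
      have h2 : b = d := by omega
      rw [h1, h2]
    · omega
    · omega
    · have h1 : a = c := by omega
      have h2 : b = d := by omega
      rw [h1, h2]
  · rintro ⟨m, k⟩
    rcases Int.even_or_odd' (m + k) with ⟨t, ht | ht⟩
    · exact ⟨.inl (t, m - t), by simp only [parMap, Prod.mk.injEq]; omega⟩
    · exact ⟨.inr (t, t - k), by simp only [parMap, Prod.mk.injEq]; omega⟩

/-- Half-integer theta function at `2τ`. -/
def Kth (τ v : ℂ) : ℂ := Complex.exp ((Real.pi : ℂ) * Complex.I * v +
  (Real.pi : ℂ) * Complex.I * τ / 2) * jacobiTheta₂ (v + τ) (2 * τ)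

lemma jac_mul {τ : ℂ} (hτ : 0 < τ.im) (p r : ℂ) :
    jacobiTheta₂ p τ * jacobiTheta₂ r τ =
      jacobiTheta₂ (p + r) (2 * τ) * jacobiTheta₂ (p - r) (2 * τ) +
        Kth τ (p + r) * Kth τ (p - r) := by
  have hτ2 : 0 < (2 * τ).im := by simpa using hτ
  have s1 : ∀ v, Summable fun k : ℤ => ‖jacobiTheta₂_term k v τ‖ := fun v =>
    ((summable_jacobiTheta₂_term_iff v τ).mpr hτ).norm
  have s2 : ∀ v, Summable fun k : ℤ => ‖jacobiTheta₂_term k v (2 * τ)‖ := fun v =>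
    ((summable_jacobiTheta₂_term_iff v (2 * τ)).mpr hτ2).norm
  have hL := (summable_mul_of_summable_norm (s1 p) (s1 r)).hasSum
  rw [← tsum_mul_tsum_of_summable_norm (s1 p) (s1 r)] at hL
  have hA := (summable_mul_of_summable_norm (s2 (p + r)) (s2 (p - r))).hasSum
  rw [← tsum_mul_tsum_of_summable_norm (s2 (p + r)) (s2 (p - r))] at hA
  have hB := (summable_mul_of_summable_norm (s2 (p + r + τ)) (s2 (p - r + τ))).hasSum
  rw [← tsum_mul_tsum_of_summable_norm (s2 (p + r + τ)) (s2 (p - r + τ))] at hB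
  have hB' := hB.mul_left (Complex.exp ((Real.pi : ℂ) * Complex.I * (p + r) +
    (Real.pi : ℂ) * Complex.I * τ / 2) * Complex.exp ((Real.pi : ℂ) * Complex.I * (p - r) +
    (Real.pi : ℂ) * Complex.I * τ / 2))
  have hL' := (Equiv.hasSum_iff (Equiv.ofBijective parMap parMap_bij)).mpr hL
  set F := (fun x : ℤ × ℤ => jacobiTheta₂_term x.1 p τ * jacobiTheta₂_term x.2 r τ) ∘
    ⇑(Equiv.ofBijective parMap parMap_bij) with hF
  have eA : F ∘ Sum.inl = fun x : ℤ × ℤ =>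
      jacobiTheta₂_term x.1 (p + r) (2 * τ) * jacobiTheta₂_term x.2 (p - r) (2 * τ) := by
    funext ⟨i, j⟩
    simp only [hF, Function.comp, Equiv.ofBijective_apply, parMap, jacobiTheta₂_term,
      ← Complex.exp_add]
    congr 1
    push_cast
    ring
  have eB : F ∘ Sum.inr = fun x : ℤ × ℤ =>
      Complex.exp ((Real.pi : ℂ) * Complex.I * (p + r) +
    (Real.pi : ℂ) * Complex.I * τ / 2) * Complex.exp ((Real.pi : ℂ) * Complex.I * (p - r) +
    (Real.pi : ℂ) * Complex.I * τ / 2) *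
      (jacobiTheta₂_term x.1 (p + r + τ) (2 * τ) *
        jacobiTheta₂_term x.2 (p - r + τ) (2 * τ)) := by
    funext ⟨i, j⟩
    simp only [hF, Function.comp, Equiv.ofBijective_apply, parMap, jacobiTheta₂_term,
      ← Complex.exp_add]
    congr 1
    push_cast
    ring
  rw [← eA] at hA
  rw [← eB] at hB'
  have key := hL'.unique (HasSum.sum hA hB')
  simp only [jacobiTheta₂, Kth] at key ⊢
  rw [key]
  ring

lemma Th_prod {τ : ℂ} (hτ : 0 < τ.im) : ∃ (C : ℂ) (A B : ℂ → ℂ), ∀ x y : ℂ,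
    Th τ (x + y) * Th τ (x - y) = C * (B x * A y - A x * B y) := by
  refine ⟨Complex.exp (2 * (Real.pi : ℂ) * Complex.I * τ / 8) ^ 2 *
    Complex.exp (-((Real.pi : ℂ) * Complex.I * τ / 2)), fun x => jacobiTheta₂ (2 * x) (2 * τ),
    fun x => Kth τ (2 * x), fun x y => ?_⟩
  have h1 : Complex.exp (2 * (Real.pi : ℂ) * Complex.I * x) *
      jacobiTheta₂ (2 * x + 1 + τ) (2 * τ) =
      Complex.exp (-((Real.pi : ℂ) * Complex.I * τ / 2)) * Kth τ (2 * x) := by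
    rw [show 2 * x + 1 + τ = 2 * x + τ + 1 by ring, jacobiTheta₂_add_left, Kth, ← mul_assoc,
      ← Complex.exp_add]
    congr 2
    ring
  have h2 : Complex.exp (2 * (Real.pi : ℂ) * Complex.I * x) * Kth τ (2 * x + 1 + τ) =
      - (Complex.exp (-((Real.pi : ℂ) * Complex.I * τ / 2)) *
        jacobiTheta₂ (2 * x) (2 * τ)) := by
    rw [Kth, show 2 * x + 1 + τ + τ = 2 * x + 2 * τ + 1 by ring, jacobiTheta₂_add_left,
      jacobiTheta₂_add_left', ← neg_mul, ← mul_assoc, ← mul_assoc, ← Complex.exp_add,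
      ← Complex.exp_add, neg_cexp]
    congr 2
    ring
  have h3 : Complex.exp ((Real.pi : ℂ) * Complex.I * (x + y)) *
      Complex.exp ((Real.pi : ℂ) * Complex.I * (x - y)) =
      Complex.exp (2 * (Real.pi : ℂ) * Complex.I * x) := by
    rw [← Complex.exp_add]; congr 1; ring
  have h4 := jac_mul hτ (x + y + (1 + τ) / 2) (x - y + (1 + τ) / 2)
  rw [show x + y + (1 + τ) / 2 + (x - y + (1 + τ) / 2) = 2 * x + 1 + τ by ring,
    show x + y + (1 + τ) / 2 - (x - y + (1 + τ) / 2) = 2 * y by ring] at h4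
  unfold Th
  rw [theta_eq, theta_eq]
  set k := Complex.exp (2 * (Real.pi : ℂ) * Complex.I * τ / 8)
  calc _ = k ^ 2 * (Complex.exp ((Real.pi : ℂ) * Complex.I * (x + y)) *
      Complex.exp ((Real.pi : ℂ) * Complex.I * (x - y))) *
      (jacobiTheta₂ (x + y + (1 + τ) / 2) τ * jacobiTheta₂ (x - y + (1 + τ) / 2) τ) := by ring
    _ = k ^ 2 * ((Complex.exp (2 * (Real.pi : ℂ) * Complex.I * x) *
      jacobiTheta₂ (2 * x + 1 + τ) (2 * τ)) * jacobiTheta₂ (2 * y) (2 * τ) +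
      (Complex.exp (2 * (Real.pi : ℂ) * Complex.I * x) * Kth τ (2 * x + 1 + τ)) *
        Kth τ (2 * y)) := by rw [h3, h4]; ring
    _ = _ := by rw [h1, h2]; ring

/-- Three-term theta identity. -/
lemma Th_three {τ : ℂ} (hτ : 0 < τ.im) (a b c d : ℂ) :
    (Th τ (a + b) * Th τ (a - b)) * (Th τ (c + d) * Th τ (c - d))
    - (Th τ (a + c) * Th τ (a - c)) * (Th τ (b + d) * Th τ (b - d))
    + (Th τ (a + d) * Th τ (a - d)) * (Th τ (b + c) * Th τ (b - c)) = 0 := by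
  obtain ⟨C, A, B, h⟩ := Th_prod hτ
  simp only [h]
  ring

lemma Th_deriv_neg (τ z : ℂ) : deriv (Th τ) (-z) = deriv (Th τ) z := by
  have h : (fun w => Th τ (-w)) = fun w => - Th τ w := funext (Th_neg τ)
  have h1 := deriv_comp_neg (Th τ) z
  rw [h, deriv.fun_neg] at h1
  linear_combination h1

lemma Th_zero (τ : ℂ) : Th τ 0 = 0 := by
  have := Th_neg τ 0
  rw [neg_zero] at this
  linear_combination this / 2

/-- Degenerate Fay identity, denominators cleared. -/
lemma Th_fay {τ : ℂ} (hτ : 0 < τ.im) (u x y : ℂ) :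
    deriv (Th τ) 0 * Th τ (u + x) * Th τ (u + y) * Th τ (x + y) =
      Th τ (u + (x + y)) * Th τ u * (deriv (Th τ) x * Th τ y + Th τ x * deriv (Th τ) y)
      - Th τ x * Th τ y *
        (deriv (Th τ) (u + (x + y)) * Th τ u - Th τ (u + (x + y)) * deriv (Th τ) u) := by
  have hd : ∀ v, HasDerivAt (Th τ) (deriv (Th τ) v) v := fun v => (Th_diff hτ v).hasDerivAt
  have hW : ∀ a c : ℂ, HasDerivAt (fun d => Th τ (a + d) * Th τ (a - d))
      (deriv (Th τ) (a + c) * Th τ (a - c) + Th τ (a + c) * (-deriv (Th τ) (a - c))) c := by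
    intro a c
    exact ((hd (a + c)).comp_const_add a c).mul ((hd (a - c)).comp_const_sub a c)
  have main : ∀ a b c : ℂ, deriv (Th τ) 0 * Th τ (c + c) * Th τ (a + b) * Th τ (a - b) =
      (deriv (Th τ) (a + c) * Th τ (a - c) - Th τ (a + c) * deriv (Th τ) (a - c)) *
        (Th τ (b + c) * Th τ (b - c)) - (Th τ (a + c) * Th τ (a - c)) *
        (deriv (Th τ) (b + c) * Th τ (b - c) - Th τ (b + c) * deriv (Th τ) (b - c)) := by
    intro a b c
    have h1 := ((((hW c c).const_mul (Th τ (a + b) * Th τ (a - b))).sub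
      ((hW b c).const_mul (Th τ (a + c) * Th τ (a - c)))).add
      ((hW a c).mul_const (Th τ (b + c) * Th τ (b - c))))
    have h2 := h1.unique ((hasDerivAt_const c (0 : ℂ)).congr_of_eventuallyEq
      (Filter.Eventually.of_forall fun d => Th_three hτ a b c d))
    rw [sub_self, Th_zero] at h2
    linear_combination -h2
  have h := main (u + (x + y) / 2) ((x - y) / 2) ((x + y) / 2)
  rw [show (x + y) / 2 + (x + y) / 2 = x + y by ring,
    show u + (x + y) / 2 + (x - y) / 2 = u + x by ring,
    show u + (x + y) / 2 - (x - y) / 2 = u + y by ring,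
    show u + (x + y) / 2 + (x + y) / 2 = u + (x + y) by ring,
    show u + (x + y) / 2 - (x + y) / 2 = u by ring,
    show (x - y) / 2 + (x + y) / 2 = x by ring,
    show (x - y) / 2 - (x + y) / 2 = -y by ring, Th_neg, Th_deriv_neg] at h
  linear_combination h

/-- If `Th` is not identically zero, its zeros all lie in the lattice. -/
lemma Th_ne_zero {τ : ℂ} (hτ : 0 < τ.im) (hne : ∃ w, Th τ w ≠ 0) {x₀ : ℂ}
    (hx : x₀ ∉ latticeGamma τ) : Th τ x₀ ≠ 0 := by
  intro h0
  have han : AnalyticOnNhd ℂ (Th τ) Set.univ :=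
    (Th_diff hτ).differentiableOn.analyticOnNhd isOpen_univ
  have han' : AnalyticOnNhd ℂ (fun x => Th τ (x₀ - x)) Set.univ :=
    ((Th_diff hτ).comp (differentiable_const x₀ |>.sub differentiable_id)).differentiableOn.analyticOnNhd
      isOpen_univ
  -- a point where both `Th x` and `Th (x₀ - x)` are nonzero
  obtain ⟨x, hx1, hx2⟩ : ∃ x, Th τ x ≠ 0 ∧ Th τ (x₀ - x) ≠ 0 := by
    by_contra! hcon
    obtain ⟨w, hw⟩ := hne
    have hev : ∀ᶠ x in nhds w, Th τ x ≠ 0 :=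
      (Th_diff hτ).continuous.continuousAt.eventually_ne hw
    have hz : (fun x => Th τ (x₀ - x)) = fun _ => 0 := by
      refine AnalyticOnNhd.eq_of_eventuallyEq (z₀ := w) han' analyticOnNhd_const ?_
      filter_upwards [hev] with x hx using hcon x hx
    exact hw (by simpa using congrFun hz (x₀ - w))
  set K := deriv (Th τ) x / Th τ x + deriv (Th τ) (x₀ - x) / Th τ (x₀ - x) with hK
  have hODE : ∀ u, deriv (Th τ) (u + x₀) * Th τ u - Th τ (u + x₀) * deriv (Th τ) u =
      K * Th τ (u + x₀) * Th τ u := by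
    intro u
    have h := Th_fay hτ u x (x₀ - x)
    rw [add_sub_cancel, h0, mul_zero] at h
    rw [hK]
    field_simp
    linear_combination h
  obtain ⟨w, hw⟩ := hne
  have hd : ∀ v, HasDerivAt (Th τ) (deriv (Th τ) v) v := fun v => (Th_diff hτ v).hasDerivAt
  have hev : ∀ᶠ x in nhds w, Th τ x ≠ 0 :=
    (Th_diff hτ).continuous.continuousAt.eventually_ne hw
  obtain ⟨r, hr, hball⟩ := Metric.eventually_nhds_iff_ball.mp hev
  set g : ℂ → ℂ := fun u => Complex.exp (-(K * u)) * Th τ (u + x₀) / Th τ u with hg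
  have hgd : ∀ u ∈ Metric.ball w r, HasDerivAt g 0 u := by
    intro u hu
    have hu' := hball u hu
    have e1 : HasDerivAt (fun u => Complex.exp (-(K * u))) (Complex.exp (-(K * u)) * -(K * 1)) u :=
      (((hasDerivAt_id u).const_mul K).neg).cexp
    have e2 := (e1.mul ((hd (u + x₀)).comp_add_const u x₀)).div (hd u) hu'
    have e3 := hODE u
    refine e2.congr_deriv ?_
    rw [div_eq_zero_iff]
    left
    simp only [Pi.mul_apply]
    linear_combination (Complex.exp (-(K * u))) * e3
  have hgc : ∀ u ∈ Metric.ball w r, g u = g w := by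
    intro u hu
    refine IsOpen.is_const_of_deriv_eq_zero Metric.isOpen_ball
      (convex_ball w r).isPreconnected ?_ ?_ hu (Metric.mem_ball_self hr)
    · exact fun v hv => (hgd v hv).differentiableAt.differentiableWithinAt
    · exact fun v hv => (hgd v hv).deriv
  have hall : (fun u => Th τ (u + x₀)) = fun u => g w * Complex.exp (K * u) * Th τ u := by
    have d1 : Differentiable ℂ (fun u => Th τ (u + x₀)) :=
      (Th_diff hτ).comp (differentiable_id.add_const x₀)
    have d2 : Differentiable ℂ (fun u => g w * Complex.exp (K * u) * Th τ u) := by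
      have := Th_diff hτ
      fun_prop
    refine AnalyticOnNhd.eq_of_eventuallyEq (z₀ := w)
      (d1.differentiableOn.analyticOnNhd isOpen_univ)
      (d2.differentiableOn.analyticOnNhd isOpen_univ) ?_
    filter_upwards [Metric.ball_mem_nhds w hr] with u hu
    have h1 := hgc u hu
    have hu' := hball u hu
    rw [← h1, hg]
    simp only [Complex.exp_neg]
    have := Complex.exp_ne_zero (K * u)
    field_simp
  have hall' : ∀ u, Th τ (u + x₀) = g w * Complex.exp (K * u) * Th τ u := fun u =>
    congrFun hall u
  have hC : g w ≠ 0 := by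
    intro hC
    have := hall' (w - x₀)
    rw [hC, sub_add_cancel] at this
    exact hw (by simpa using this)
  clear_value g
  have p1 : Complex.exp K = 1 := by
    have h1 := hall' (w + 1)
    rw [show w + 1 + x₀ = w + x₀ + 1 by ring, Th_add_one, Th_add_one, hall' w, mul_add,
      Complex.exp_add, mul_one] at h1
    have : g w * Complex.exp (K * w) * Th τ w ≠ 0 :=
      mul_ne_zero (mul_ne_zero hC (Complex.exp_ne_zero _)) hw
    apply mul_left_cancel₀ this
    linear_combination h1
  have p2 : Complex.exp (-(2 * (Real.pi : ℂ) * Complex.I * x₀)) = Complex.exp (K * τ) := by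
    have h1 := hall' (w + τ)
    rw [show w + τ + x₀ = w + x₀ + τ by ring, Th_add_tau, Th_add_tau, hall' w, mul_add K,
      Complex.exp_add, show -((Real.pi : ℂ) * Complex.I * (τ + 2 * (w + x₀))) =
      -((Real.pi : ℂ) * Complex.I * (τ + 2 * w)) + -(2 * (Real.pi : ℂ) * Complex.I * x₀) by ring,
      Complex.exp_add] at h1
    have : g w * Complex.exp (K * w) * Th τ w *
        Complex.exp (-((Real.pi : ℂ) * Complex.I * (τ + 2 * w))) ≠ 0 :=
      mul_ne_zero (mul_ne_zero (mul_ne_zero hC (Complex.exp_ne_zero _)) hw)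
        (Complex.exp_ne_zero _)
    apply mul_left_cancel₀ this
    linear_combination -h1
  obtain ⟨m, hm⟩ := Complex.exp_eq_one_iff.mp p1
  obtain ⟨k, hk⟩ := Complex.exp_eq_exp_iff_exists_int.mp p2
  apply hx
  refine ⟨-k, -m, ?_⟩
  have hpi : 2 * (Real.pi : ℂ) * Complex.I ≠ 0 := Complex.two_pi_I_ne_zero
  apply mul_left_cancel₀ hpi
  rw [hm] at hk
  push_cast
  linear_combination -hk

lemma kronPhi_eq {τ : ℂ} (hτ : 0 < τ.im) (u z : ℂ) :
    kronPhi τ u z = Th τ (u + z) * deriv (Th τ) 0 / (Th τ u * Th τ z) := by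
  have h0 : theta τ 0 = 0 := by
    have := Th_zero τ
    simpa [Th] using this
  have h1 : HasDerivAt (Th τ) (Complex.exp ((Real.pi : ℂ) * Complex.I * 0) *
      ((Real.pi : ℂ) * Complex.I * 1) * theta τ 0 +
      Complex.exp ((Real.pi : ℂ) * Complex.I * 0) * deriv (theta τ) 0) 0 :=
    (((hasDerivAt_id (0 : ℂ)).const_mul ((Real.pi : ℂ) * Complex.I)).cexp).mul
      (theta_diff hτ 0).hasDerivAt
  have h2 : deriv (Th τ) 0 = deriv (theta τ) 0 := by
    rw [h1.deriv, h0]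
    simp
  rw [h2]
  unfold kronPhi Th
  rw [mul_add, Complex.exp_add]
  rw [show Complex.exp ((Real.pi : ℂ) * Complex.I * u) * Complex.exp ((Real.pi : ℂ) * Complex.I * z)
      * theta τ (u + z) * deriv (theta τ) 0 =
    (Complex.exp ((Real.pi : ℂ) * Complex.I * u) * Complex.exp ((Real.pi : ℂ) * Complex.I * z)) *
      (theta τ (u + z) * deriv (theta τ) 0) by ring,
    show Complex.exp ((Real.pi : ℂ) * Complex.I * u) * theta τ u *
      (Complex.exp ((Real.pi : ℂ) * Complex.I * z) * theta τ z) =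
    (Complex.exp ((Real.pi : ℂ) * Complex.I * u) * Complex.exp ((Real.pi : ℂ) * Complex.I * z)) *
      (theta τ u * theta τ z) by ring]
  rw [mul_div_mul_left]
  exact mul_ne_zero (Complex.exp_ne_zero _) (Complex.exp_ne_zero _)

/-- Logarithmic derivative of `Th`. -/
def Lth (τ z : ℂ) : ℂ := deriv (Th τ) z / Th τ z

lemma Lth_neg (τ z : ℂ) : Lth τ (-z) = - Lth τ z := by
  unfold Lth
  rw [Th_neg, Th_deriv_neg, div_neg]

lemma E1_eq {τ : ℂ} (hτ : 0 < τ.im) {z : ℂ} (hz : Th τ z ≠ 0) :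
    E1 τ z = Lth τ z - (Real.pi : ℂ) * Complex.I := by
  have h1 : HasDerivAt (Th τ) (Complex.exp ((Real.pi : ℂ) * Complex.I * z) *
      ((Real.pi : ℂ) * Complex.I * 1) * theta τ z +
      Complex.exp ((Real.pi : ℂ) * Complex.I * z) * deriv (theta τ) z) z :=
    (((hasDerivAt_id z).const_mul ((Real.pi : ℂ) * Complex.I)).cexp).mul
      (theta_diff hτ z).hasDerivAt
  have h2 : theta τ z ≠ 0 := fun h => hz (by simp [Th, h])
  have h3 := Complex.exp_ne_zero ((Real.pi : ℂ) * Complex.I * z)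
  unfold Lth E1
  rw [h1.deriv, Th]
  field_simp
  ring

lemma kronF_eq {τ : ℂ} (hτ : 0 < τ.im) {u : ℂ} (z : ℂ) (hu : Th τ u ≠ 0) :
    kronF τ u z = deriv (Th τ) 0 / Th τ z *
      ((deriv (Th τ) (u + z) * Th τ u - Th τ (u + z) * deriv (Th τ) u) / Th τ u ^ 2) := by
  have h : (fun u' => kronPhi τ u' z) =
      fun u' => deriv (Th τ) 0 / Th τ z * (Th τ (u' + z) / Th τ u') := by
    funext v
    rw [kronPhi_eq hτ]
    rw [div_mul_div_comm, mul_comm (Th τ (v + z)), mul_comm (Th τ v)]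
  have hd : ∀ v, HasDerivAt (Th τ) (deriv (Th τ) v) v := fun v => (Th_diff hτ v).hasDerivAt
  unfold kronF
  rw [h]
  exact ((((hd (u + z)).comp_add_const u z).div (hd u) hu).const_mul _).deriv

lemma kron_fay {τ : ℂ} (hτ : 0 < τ.im) {u x y : ℂ} (hu : Th τ u ≠ 0) (hx : Th τ x ≠ 0)
    (hy : Th τ y ≠ 0) (hxy : Th τ (x + y) ≠ 0) :
    kronPhi τ u x * kronPhi τ u y =
      kronPhi τ u (x + y) * (Lth τ x + Lth τ y) - kronF τ u (x + y) := by
  rw [kronF_eq hτ _ hu, kronPhi_eq hτ, kronPhi_eq hτ, kronPhi_eq hτ, Lth, Lth]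
  have h := Th_fay hτ u x y
  field_simp
  linear_combination (deriv (Th τ) 0) * h

lemma kronPhi_neg {τ : ℂ} (hτ : 0 < τ.im) (u z : ℂ) :
    kronPhi τ (-u) (-z) = - kronPhi τ u z := by
  rw [kronPhi_eq hτ, kronPhi_eq hτ, ← neg_add, Th_neg, Th_neg, Th_neg, neg_mul_neg, neg_mul,
    neg_div]

lemma kronF_neg {τ : ℂ} (hτ : 0 < τ.im) (u z : ℂ) : kronF τ (-u) (-z) = kronF τ u z := by
  have h := deriv_comp_neg (fun u' => kronPhi τ u' (-z)) u
  simp only [kronPhi_neg hτ, deriv.fun_neg] at h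
  unfold kronF
  linear_combination h

lemma kronPhi_add_one {τ : ℂ} (hτ : 0 < τ.im) (u z : ℂ) :
    kronPhi τ (u + 1) z = kronPhi τ u z := by
  rw [kronPhi_eq hτ, kronPhi_eq hτ, show u + 1 + z = u + z + 1 by ring, Th_add_one, Th_add_one,
    neg_mul, neg_mul, neg_div_neg_eq]

lemma kronPhi_add_tau {τ : ℂ} (hτ : 0 < τ.im) (u z : ℂ) :
    kronPhi τ (u + τ) z = Complex.exp (-(2 * (Real.pi : ℂ) * Complex.I * z)) * kronPhi τ u z := by
  rw [kronPhi_eq hτ, kronPhi_eq hτ, show u + τ + z = u + z + τ by ring, Th_add_tau, Th_add_tau,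
    show -((Real.pi : ℂ) * Complex.I * (τ + 2 * (u + z))) =
      -(2 * (Real.pi : ℂ) * Complex.I * z) + -((Real.pi : ℂ) * Complex.I * (τ + 2 * u)) by ring,
    Complex.exp_add]
  have h := Complex.exp_ne_zero (-((Real.pi : ℂ) * Complex.I * (τ + 2 * u)))
  rw [neg_mul, neg_mul, neg_div_neg_eq]
  rw [show Complex.exp (-(2 * (Real.pi : ℂ) * Complex.I * z)) *
      Complex.exp (-((Real.pi : ℂ) * Complex.I * (τ + 2 * u))) * Th τ (u + z) * deriv (Th τ) 0 =
    Complex.exp (-((Real.pi : ℂ) * Complex.I * (τ + 2 * u))) *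
    (Complex.exp (-(2 * (Real.pi : ℂ) * Complex.I * z)) * (Th τ (u + z) * deriv (Th τ) 0)) by ring,
    mul_assoc (Complex.exp (-((Real.pi : ℂ) * Complex.I * (τ + 2 * u)))) (Th τ u),
    mul_div_mul_left _ _ h, mul_div_assoc]

lemma kronPhi_add_int {τ : ℂ} (hτ : 0 < τ.im) (k : ℤ) (z : ℂ) :
    ∀ u, kronPhi τ (u + k) z = kronPhi τ u z := by
  induction k using Int.induction_on with
  | zero => intro u; simp
  | succ i ih =>
    intro u
    push_cast
    rw [← add_assoc, kronPhi_add_one hτ]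
    exact_mod_cast ih u
  | pred i ih =>
    intro u
    rw [← kronPhi_add_one hτ, ← ih u]
    push_cast
    congr 1
    ring

lemma kronPhi_add_int_tau {τ : ℂ} (hτ : 0 < τ.im) (l : ℤ) (z : ℂ) :
    ∀ u, kronPhi τ (u + l * τ) z =
      Complex.exp (-(2 * (Real.pi : ℂ) * Complex.I * (l * z))) * kronPhi τ u z := by
  induction l using Int.induction_on with
  | zero => intro u; simp
  | succ i ih =>
    intro u
    push_cast at ih ⊢
    rw [show u + ((i : ℂ) + 1) * τ = u + i * τ + τ by ring, kronPhi_add_tau hτ, ih u,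
      ← mul_assoc, ← Complex.exp_add]
    congr 2
    ring
  | pred i ih =>
    intro u
    have h := kronPhi_add_tau hτ (u + ((-(i : ℤ) - 1 : ℤ) : ℂ) * τ) z
    push_cast at ih h ⊢
    rw [show u + (-(i : ℂ) - 1) * τ + τ = u + -(i : ℂ) * τ by ring, ih u] at h
    apply mul_left_cancel₀ (Complex.exp_ne_zero (-(2 * (Real.pi : ℂ) * Complex.I * z)))
    rw [← h, ← mul_assoc (Complex.exp (-(2 * (Real.pi : ℂ) * Complex.I * z))),
      ← Complex.exp_add]
    congr 2
    ring

lemma kronF_shift {τ : ℂ} (hτ : 0 < τ.im) (k l : ℤ) (u z : ℂ) :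
    kronF τ (u + k + l * τ) z =
      Complex.exp (-(2 * (Real.pi : ℂ) * Complex.I * (l * z))) * kronF τ u z := by
  have h := deriv_comp_add_const (fun u' => kronPhi τ u' z) ((k : ℂ) + l * τ) u
  have h2 : ∀ v : ℂ, kronPhi τ (v + (k + l * τ)) z =
      Complex.exp (-(2 * (Real.pi : ℂ) * Complex.I * (l * z))) * kronPhi τ v z := by
    intro v
    rw [← add_assoc, kronPhi_add_int_tau hτ, kronPhi_add_int hτ]
  simp only [h2, deriv_const_mul_field'] at h
  unfold kronF
  rw [add_assoc, ← h]

lemma eN_shift {N : ℕ} (hN : N ≠ 0) (g l w : ℂ) :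
    eN N ((-g + N * l) * -w) * Complex.exp (-(2 * (Real.pi : ℂ) * Complex.I * (l * -w))) =
      eN N (g * w) := by
  have : (N : ℂ) ≠ 0 := by exact_mod_cast hN
  unfold eN
  rw [← Complex.exp_add]
  congr 1
  field_simp
  ring

lemma om_shift {N : ℕ} (hN : N ≠ 0) (τ : ℂ) {α β : ℤ × ℤ} {k l : ℤ}
    (h1 : β.1 = -α.1 + N * k) (h2 : β.2 = -α.2 + N * l) :
    om N τ β = -om N τ α + k + l * τ := by
  have : (N : ℂ) ≠ 0 := by exact_mod_cast hN
  unfold om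
  rw [h1, h2]
  push_cast
  field_simp
  ring

lemma phiG_neg {τ : ℂ} (hτ : 0 < τ.im) {N : ℕ} (hN : N ≠ 0) {α β : ℤ × ℤ}
    (h1 : (N : ℤ) ∣ α.1 + β.1) (h2 : (N : ℤ) ∣ α.2 + β.2) (w : ℂ) :
    phiG N τ β (-w) = - phiG N τ α w := by
  obtain ⟨k, hk⟩ := h1
  obtain ⟨l, hl⟩ := h2
  have e1 : β.1 = -α.1 + N * k := by linarith
  have e2 : β.2 = -α.2 + N * l := by linarith
  unfold phiG
  rw [om_shift hN τ e1 e2, kronPhi_add_int_tau hτ, kronPhi_add_int hτ, kronPhi_neg hτ, e2,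
    ← eN_shift hN (α.2 : ℂ) l w]
  push_cast
  ring

lemma fG_neg {τ : ℂ} (hτ : 0 < τ.im) {N : ℕ} (hN : N ≠ 0) {α β : ℤ × ℤ}
    (h1 : (N : ℤ) ∣ α.1 + β.1) (h2 : (N : ℤ) ∣ α.2 + β.2) (w : ℂ) :
    fG N τ β (-w) = fG N τ α w := by
  obtain ⟨k, hk⟩ := h1
  obtain ⟨l, hl⟩ := h2
  have e1 : β.1 = -α.1 + N * k := by linarith
  have e2 : β.2 = -α.2 + N * l := by linarith
  unfold fG
  rw [om_shift hN τ e1 e2, kronF_shift hτ, kronF_neg hτ, e2, ← eN_shift hN (α.2 : ℂ) l w]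
  push_cast
  ring

lemma mem_GammaN' {N : ℕ} {γ : ℤ × ℤ} (h : γ ∈ GammaN' N) :
    ∃ p r : ℕ, p < N ∧ r < N ∧ γ = ((p : ℤ), (r : ℤ)) ∧ ¬ (p = 0 ∧ r = 0) := by
  unfold GammaN' at h
  rw [Finset.mem_sdiff, Finset.mem_image] at h
  obtain ⟨⟨⟨p, r⟩, hp, rfl⟩, h2⟩ := h
  simp only [Finset.mem_product, Finset.mem_range] at hp
  refine ⟨p, r, hp.1, hp.2, rfl, ?_⟩
  rintro ⟨rfl, rfl⟩
  simp at h2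

lemma om_not_lattice {τ : ℂ} (hτ : 0 < τ.im) {N : ℕ} {γ : ℤ × ℤ} (h : γ ∈ GammaN' N) :
    om N τ γ ∉ latticeGamma τ := by
  obtain ⟨p, r, hp, hr, rfl, h0⟩ := mem_GammaN' h
  rintro ⟨m, k, hmk⟩
  have hN : (N : ℂ) ≠ 0 := by
    have : N ≠ 0 := by omega
    exact_mod_cast this
  have e : (p : ℂ) + r * τ = N * (m + k * τ) := by
    rw [← hmk, om]
    push_cast
    field_simp
  have him := congrArg Complex.im e
  have hre := congrArg Complex.re e
  simp at him hre
  have h1 : ((r : ℤ) : ℝ) = ((N * k : ℤ) : ℝ) := by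
    push_cast
    apply mul_right_cancel₀ hτ.ne'
    linarith
  have h2 : (r : ℤ) = N * k := by exact_mod_cast h1
  have h3 : ((p : ℤ) : ℝ) = ((N * m : ℤ) : ℝ) := by
    push_cast at h1 ⊢
    rw [h1] at hre
    linarith
  have h4 : (p : ℤ) = N * m := by exact_mod_cast h3
  have h5 : r = 0 := by
    refine Nat.eq_zero_of_dvd_of_lt ?_ hr
    exact_mod_cast (Dvd.intro k h2.symm : (N : ℤ) ∣ r)
  have h6 : p = 0 := by
    refine Nat.eq_zero_of_dvd_of_lt ?_ hp
    exact_mod_cast (Dvd.intro m h4.symm : (N : ℤ) ∣ p)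
  exact h0 ⟨h6, h5⟩

/-- The scalar identity behind (q017). -/
lemma phiG_fay {τ : ℂ} (hτ : 0 < τ.im) {N : ℕ} {γ : ℤ × ℤ} (h : γ ∈ GammaN' N)
    {x y : ℂ} (hx : x ∉ latticeGamma τ) (hy : y ∉ latticeGamma τ)
    (hxy : x + y ∉ latticeGamma τ) :
    phiG N τ γ x * phiG N τ γ y =
      phiG N τ γ (x + y) * (E1 τ x - E1 τ (-y)) - fG N τ γ (x + y) := by
  by_cases hne : ∃ w, Th τ w ≠ 0
  · have nx := Th_ne_zero hτ hne hx
    have ny := Th_ne_zero hτ hne hy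
    have nxy := Th_ne_zero hτ hne hxy
    have nu := Th_ne_zero hτ hne (om_not_lattice hτ h)
    have ny' : Th τ (-y) ≠ 0 := by rw [Th_neg]; exact neg_ne_zero.mpr ny
    have key := kron_fay hτ nu nx ny nxy
    have hE : eN N ((γ.2 : ℂ) * (x + y)) = eN N ((γ.2 : ℂ) * x) * eN N ((γ.2 : ℂ) * y) := by
      unfold eN
      rw [← Complex.exp_add]
      congr 1
      ring
    unfold phiG fG
    rw [E1_eq hτ nx, E1_eq hτ ny', Lth_neg, hE]
    linear_combination (eN N ((γ.2 : ℂ) * x) * eN N ((γ.2 : ℂ) * y)) * key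
  · push Not at hne
    have hphi : ∀ u v, kronPhi τ u v = 0 := by
      intro u v
      rw [kronPhi_eq hτ]
      simp [hne]
    have hf : ∀ u v, kronF τ u v = 0 := by
      intro u v
      unfold kronF
      simp [hphi]
    simp [phiG, fG, hphi, hf]

/-! ### Orthogonality of the basis -/

/-- `U X = c X U`. -/
def QComm {N : ℕ} (U X : Matrix (Fin N) (Fin N) ℂ) (c : ℂ) : Prop := U * X = c • (X * U)

lemma QComm.mul {N : ℕ} {U X Y : Matrix (Fin N) (Fin N) ℂ} {c d : ℂ} (hX : QComm U X c)
    (hY : QComm U Y d) : QComm U (X * Y) (c * d) := by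
  unfold QComm at *
  rw [← mul_assoc, hX, smul_mul_assoc, mul_assoc, hY, mul_smul_comm, smul_smul, mul_assoc]

lemma QComm.pow {N : ℕ} {U X : Matrix (Fin N) (Fin N) ℂ} {c : ℂ} (hX : QComm U X c) (k : ℕ) :
    QComm U (X ^ k) (c ^ k) := by
  induction k with
  | zero => simp [QComm]
  | succ k ih => rw [pow_succ, pow_succ]; exact ih.mul hX

lemma QComm.smul {N : ℕ} {U X : Matrix (Fin N) (Fin N) ℂ} {c : ℂ} (hX : QComm U X c) (t : ℂ) :
    QComm U (t • X) c := by
  unfold QComm at *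
  rw [mul_smul_comm, hX, smul_mul_assoc, smul_comm]

lemma QComm.trace_zero {N : ℕ} {U V X : Matrix (Fin N) (Fin N) ℂ} {c : ℂ} (hX : QComm U X c)
    (hV : V * U = 1) (hc : c ≠ 1) : Matrix.trace X = 0 := by
  have hV' : U * V = 1 := mul_eq_one_comm.mp hV
  have h : Matrix.trace X = c * Matrix.trace X := by
    calc Matrix.trace X = Matrix.trace (V * (U * X)) := by rw [← mul_assoc, hV, one_mul]
      _ = c * Matrix.trace (V * (X * U)) := by
        rw [hX, mul_smul_comm, Matrix.trace_smul, smul_eq_mul]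
      _ = c * Matrix.trace X := by
        rw [Matrix.trace_mul_comm, mul_assoc, hV', mul_one]
  have h2 : (1 - c) * Matrix.trace X = 0 := by linear_combination h
  rcases mul_eq_zero.mp h2 with h3 | h3
  · exact absurd (sub_eq_zero.mp h3).symm hc
  · exact h3

lemma eN_add (N : ℕ) (x y : ℂ) : eN N (x + y) = eN N x * eN N y := by
  unfold eN
  rw [← Complex.exp_add]
  congr 1
  ring

lemma eN_nat (N k : ℕ) : eN N (k : ℂ) = eN N 1 ^ k := by
  unfold eN
  rw [← Complex.exp_nat_mul]
  congr 1
  ring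

lemma eN_prim {N : ℕ} (hN : N ≠ 0) : IsPrimitiveRoot (eN N 1) N := by
  have := Complex.isPrimitiveRoot_exp N hN
  unfold eN
  rwa [mul_one]

lemma eN_ne {N : ℕ} (x : ℂ) : eN N x ≠ 0 := Complex.exp_ne_zero _

lemma Qm_inv (N : ℕ) : (Matrix.diagonal fun i : Fin N => (eN N ((i : ℕ) + 1))⁻¹) * Qm N = 1 := by
  unfold Qm
  rw [Matrix.diagonal_mul_diagonal, ← Matrix.diagonal_one]
  congr 1
  funext i
  exact inv_mul_cancel₀ (eN_ne _)

lemma Lm_inv (N : ℕ) : Lm N * (Lm N)ᵀ = 1 := by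
  ext i j
  have hlt : ∀ i : Fin N, ((i : ℕ) + 1) % N < N := fun i => Nat.mod_lt _ (by have := i.2; omega)
  rw [Matrix.mul_apply, Matrix.one_apply]
  rw [Finset.sum_eq_single (⟨((i : ℕ) + 1) % N, hlt i⟩ : Fin N)]
  · simp only [Lm, Matrix.of_apply, Matrix.transpose_apply, if_true, one_mul]
    by_cases h : i = j
    · simp [h]
    · rw [if_neg h, if_neg]
      intro h2
      apply h
      have h3 : (j : ℕ) + 1 ≡ i + 1 [MOD N] := h2
      have h4 : (j : ℕ) ≡ i [MOD N] := Nat.ModEq.add_right_cancel' 1 h3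
      exact Fin.ext (Nat.ModEq.eq_of_lt_of_lt h4 j.2 i.2).symm
  · intro k _ hk
    simp only [Lm, Matrix.of_apply, Matrix.transpose_apply]
    rw [if_neg, zero_mul]
    intro h
    exact hk (Fin.ext h.symm)
  · simp

lemma Lm_comm_Qm {N : ℕ} (hN : N ≠ 0) : QComm (Lm N) (Qm N) (eN N 1) := by
  unfold QComm
  ext i j
  simp only [Qm, Matrix.mul_diagonal, Matrix.smul_apply, Matrix.diagonal_mul, smul_eq_mul, Lm,
    Matrix.of_apply]
  by_cases h : ((i : ℕ) + 1) % N = (j : ℕ)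
  · rw [if_pos h, one_mul, mul_one, ← eN_add]
    have e1 : eN N ((j : ℕ) + 1) = eN N 1 ^ ((j : ℕ) + 1) := by
      rw [← eN_nat]; push_cast; rfl
    have e2 : eN N (1 + ((i : ℕ) + 1)) = eN N 1 ^ ((i : ℕ) + 1 + 1) := by
      rw [← eN_nat]; push_cast; congr 1; ring
    rw [e1, e2, pow_succ, pow_succ _ ((i : ℕ) + 1), ← h]
    congr 1
    conv_rhs => rw [← Nat.mod_add_div ((i : ℕ) + 1) N, pow_add, pow_mul, (eN_prim hN).pow_eq_one,
      one_pow, mul_one]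
  · simp [h]

lemma Qm_comm_Lm {N : ℕ} (hN : N ≠ 0) : QComm (Qm N) (Lm N) (eN N 1)⁻¹ := by
  have := Lm_comm_Qm hN
  unfold QComm at *
  rw [this, smul_smul, inv_mul_cancel₀ (eN_ne _), one_smul]

lemma QComm_self {N : ℕ} (U : Matrix (Fin N) (Fin N) ℂ) : QComm U U 1 := by
  simp [QComm]

lemma trace_Tm {N : ℕ} (hN : N ≠ 0) {α β : ℤ × ℤ} (hα : α ∈ GammaN' N) (hβ : β ∈ GammaN' N)
    (h : Matrix.trace (Tm N α * Tm N β) ≠ 0) :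
    (N : ℤ) ∣ α.1 + β.1 ∧ (N : ℤ) ∣ α.2 + β.2 := by
  obtain ⟨p, r, -, -, rfl, -⟩ := mem_GammaN' hα
  obtain ⟨s, t, -, -, rfl, -⟩ := mem_GammaN' hβ
  have hζ := eN_prim hN
  constructor
  · by_contra hd
    apply h
    have hd' : ¬ N ∣ p + s := by
      simp only at hd
      exact_mod_cast hd
    have hT : ∀ p r : ℕ, QComm (Lm N) (Tm N ((p : ℤ), (r : ℤ))) (eN N 1 ^ p) := by
      intro p r
      unfold Tm
      simp only [zpow_natCast]
      have := (((Lm_comm_Qm hN).pow p).mul ((QComm_self (Lm N)).pow r)).smul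
        (eN N (((((p : ℤ) * (r : ℤ) : ℤ)) : ℂ) / 2))
      simpa using this
    refine ((hT p r).mul (hT s t)).trace_zero (mul_eq_one_comm.mp (Lm_inv N)) ?_
    rw [← pow_add]
    exact fun h1 => hd' ((hζ.pow_eq_one_iff_dvd _).mp h1)
  · by_contra hd
    apply h
    have hd' : ¬ N ∣ r + t := by
      simp only at hd
      exact_mod_cast hd
    have hT : ∀ p r : ℕ, QComm (Qm N) (Tm N ((p : ℤ), (r : ℤ))) ((eN N 1)⁻¹ ^ r) := by
      intro p r
      unfold Tm
      simp only [zpow_natCast]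
      have := (((QComm_self (Qm N)).pow p).mul ((Qm_comm_Lm hN).pow r)).smul
        (eN N (((((p : ℤ) * (r : ℤ) : ℤ)) : ℂ) / 2))
      simpa using this
    refine ((hT p r).mul (hT s t)).trace_zero (Qm_inv N) ?_
    rw [← pow_add, inv_pow]
    exact fun h1 => hd' ((hζ.pow_eq_one_iff_dvd _).mp (inv_eq_one.mp h1))

/-- The bilinear form `⟨S^b ĝ(S^c)⟩`. -/
def Bf (N : ℕ) {n : ℕ} (S : Fin n → (ℤ × ℤ) → ℂ) (b c : Fin n) (g : ℤ × ℤ → ℂ) : ℂ :=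
  Matrix.trace (SmatC N S b * ∑ γ ∈ GammaN' N, (S c γ * g γ) • Tm N γ)

lemma Bf_eq (N : ℕ) {n : ℕ} (S : Fin n → (ℤ × ℤ) → ℂ) (b c : Fin n) (g : ℤ × ℤ → ℂ) :
    Bf N S b c g = ∑ α ∈ GammaN' N, ∑ β ∈ GammaN' N,
      S b α * S c β * g β * Matrix.trace (Tm N α * Tm N β) := by
  unfold Bf SmatC
  rw [Finset.sum_mul_sum, Matrix.trace_sum]
  refine Finset.sum_congr rfl fun α _ => ?_
  rw [Matrix.trace_sum]
  refine Finset.sum_congr rfl fun β _ => ?_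
  rw [smul_mul_assoc, mul_smul_comm, Matrix.trace_smul, Matrix.trace_smul, smul_eq_mul,
    smul_eq_mul]
  ring

lemma Bf_symm {N : ℕ} (hN : N ≠ 0) {n : ℕ} (S : Fin n → (ℤ × ℤ) → ℂ) (b c : Fin n)
    {g h : ℤ × ℤ → ℂ}
    (hgh : ∀ α β, (N : ℤ) ∣ α.1 + β.1 → (N : ℤ) ∣ α.2 + β.2 → g β = h α) :
    Bf N S b c g = Bf N S c b h := by
  rw [Bf_eq, Bf_eq, Finset.sum_comm]
  refine Finset.sum_congr rfl fun β hβ => Finset.sum_congr rfl fun α hα => ?_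
  rw [Matrix.trace_mul_comm (Tm N β)]
  by_cases ht : Matrix.trace (Tm N α * Tm N β) = 0
  · rw [ht, mul_zero, mul_zero]
  · obtain ⟨h1, h2⟩ := trace_Tm hN hα hβ ht
    rw [hgh α β h1 h2]
    ring

lemma Bf_lin {N : ℕ} {n : ℕ} (S : Fin n → (ℤ × ℤ) → ℂ) (b c : Fin n)
    {g g₁ g₂ : ℤ × ℤ → ℂ} (t : ℂ) (h : ∀ γ ∈ GammaN' N, g γ = t * g₁ γ - g₂ γ) :
    Bf N S b c g = t * Bf N S b c g₁ - Bf N S b c g₂ := by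
  rw [Bf_eq, Bf_eq, Bf_eq, Finset.mul_sum, ← Finset.sum_sub_distrib]
  refine Finset.sum_congr rfl fun α _ => ?_
  rw [Finset.mul_sum, ← Finset.sum_sub_distrib]
  refine Finset.sum_congr rfl fun β hβ => ?_
  rw [h β hβ]
  ring

lemma sum_swap {n : ℕ} (a : Fin n) (G : Fin n → Fin n → ℂ) :
    ∑ c ∈ Finset.univ.filter (fun c => c ≠ a),
      ∑ b ∈ Finset.univ.filter (fun b => b ≠ a ∧ b ≠ c), G c b =
    ∑ c ∈ Finset.univ.filter (fun c => c ≠ a),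
      ∑ b ∈ Finset.univ.filter (fun b => b ≠ a ∧ b ≠ c), G b c := by
  refine Finset.sum_comm' ?_
  intro x y
  simp only [Finset.mem_filter, Finset.mem_univ, true_and]
  constructor
  · rintro ⟨h1, h2, h3⟩; exact ⟨⟨h1, h3.symm⟩, h2⟩
  · rintro ⟨⟨h1, h3⟩, h2⟩; exact ⟨h1, h2, h3.symm⟩

lemma sum_split {n : ℕ} (a c : Fin n) (hca : c ≠ a) (G : Fin n → ℂ) :
    ∑ b ∈ Finset.univ.filter (fun b => b ≠ c), G b =
      G a + ∑ b ∈ Finset.univ.filter (fun b => b ≠ a ∧ b ≠ c), G b := by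
  have : Finset.univ.filter (fun b => b ≠ c) =
      insert a (Finset.univ.filter (fun b : Fin n => b ≠ a ∧ b ≠ c)) := by
    ext b
    simp only [Finset.mem_filter, Finset.mem_univ, true_and, Finset.mem_insert]
    by_cases h : b = a
    · subst h; simp [hca.symm]
    · simp [h]
  rw [this, Finset.sum_insert (by simp)]

lemma sum_split_all {n : ℕ} (a : Fin n) (G : Fin n → ℂ) :
    ∑ b, G b = G a + ∑ b ∈ Finset.univ.filter (fun b => b ≠ a), G b := by
  rw [Finset.filter_ne', Finset.add_sum_erase _ _ (Finset.mem_univ a)]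

/-- The purely combinatorial part of the identity. -/
lemma comb_identity {n : ℕ} (a : Fin n) (X Y Z : Fin n → Fin n → ℂ) (F e : Fin n → ℂ)
    (hX : ∀ b c, X b c = X c b) (hY : ∀ b c, Y b c = - Y c b)
    (hF : ∀ c, F c = e c * Y a c - X a c)
    (hZ : ∀ c b, c ≠ a → b ≠ a → b ≠ c → Z c b = (e b - e c) * Y c b - X c b) :
    -(∑ b, ∑ c ∈ Finset.univ.filter (fun c => c ≠ b), X b c)
      - 2 * (∑ c ∈ Finset.univ.filter (fun c => c ≠ a),
          e c * ∑ b ∈ Finset.univ.filter (fun b => b ≠ c), Y c b) =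
    2 * (∑ c ∈ Finset.univ.filter (fun c => c ≠ a), F c) +
      ∑ c ∈ Finset.univ.filter (fun c => c ≠ a),
        ∑ b ∈ Finset.univ.filter (fun b => b ≠ a ∧ b ≠ c), Z c b := by
  have hZs : ∑ c ∈ Finset.univ.filter (fun c => c ≠ a),
        ∑ b ∈ Finset.univ.filter (fun b => b ≠ a ∧ b ≠ c), Z c b =
      ∑ c ∈ Finset.univ.filter (fun c => c ≠ a),
        ∑ b ∈ Finset.univ.filter (fun b => b ≠ a ∧ b ≠ c), (e b * Y c b)
      - ∑ c ∈ Finset.univ.filter (fun c => c ≠ a),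
        ∑ b ∈ Finset.univ.filter (fun b => b ≠ a ∧ b ≠ c), (e c * Y c b)
      - ∑ c ∈ Finset.univ.filter (fun c => c ≠ a),
        ∑ b ∈ Finset.univ.filter (fun b => b ≠ a ∧ b ≠ c), X c b := by
    rw [← Finset.sum_sub_distrib, ← Finset.sum_sub_distrib]
    refine Finset.sum_congr rfl fun c hc => ?_
    rw [← Finset.sum_sub_distrib, ← Finset.sum_sub_distrib]
    refine Finset.sum_congr rfl fun b hb => ?_
    simp only [Finset.mem_filter, Finset.mem_univ, true_and] at hc hb
    rw [hZ c b hc hb.1 hb.2]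
    ring
  have hsw : ∑ c ∈ Finset.univ.filter (fun c => c ≠ a),
        ∑ b ∈ Finset.univ.filter (fun b => b ≠ a ∧ b ≠ c), (e b * Y c b) =
      - ∑ c ∈ Finset.univ.filter (fun c => c ≠ a),
        ∑ b ∈ Finset.univ.filter (fun b => b ≠ a ∧ b ≠ c), (e c * Y c b) := by
    rw [sum_swap a (fun c b => e b * Y c b), ← Finset.sum_neg_distrib]
    refine Finset.sum_congr rfl fun c _ => ?_
    rw [← Finset.sum_neg_distrib]
    refine Finset.sum_congr rfl fun b _ => ?_
    rw [hY b c]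
    ring
  have hXs : ∑ b, ∑ c ∈ Finset.univ.filter (fun c => c ≠ b), X b c =
      2 * ∑ c ∈ Finset.univ.filter (fun c => c ≠ a), X a c +
      ∑ c ∈ Finset.univ.filter (fun c => c ≠ a),
        ∑ b ∈ Finset.univ.filter (fun b => b ≠ a ∧ b ≠ c), X c b := by
    rw [sum_split_all a]
    have : ∑ b ∈ Finset.univ.filter (fun b => b ≠ a),
        ∑ c ∈ Finset.univ.filter (fun c => c ≠ b), X b c =
        ∑ b ∈ Finset.univ.filter (fun b => b ≠ a), (X a b +
          ∑ c ∈ Finset.univ.filter (fun c => c ≠ a ∧ c ≠ b), X b c) := by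
      refine Finset.sum_congr rfl fun b hb => ?_
      simp only [Finset.mem_filter, Finset.mem_univ, true_and] at hb
      rw [sum_split a b hb, hX b a]
    rw [this, Finset.sum_add_distrib]
    ring
  have hYs : ∑ c ∈ Finset.univ.filter (fun c => c ≠ a),
          e c * ∑ b ∈ Finset.univ.filter (fun b => b ≠ c), Y c b =
      - ∑ c ∈ Finset.univ.filter (fun c => c ≠ a), e c * Y a c +
      ∑ c ∈ Finset.univ.filter (fun c => c ≠ a),
        ∑ b ∈ Finset.univ.filter (fun b => b ≠ a ∧ b ≠ c), (e c * Y c b) := by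
    rw [← Finset.sum_neg_distrib, ← Finset.sum_add_distrib]
    refine Finset.sum_congr rfl fun c hc => ?_
    simp only [Finset.mem_filter, Finset.mem_univ, true_and] at hc
    rw [sum_split a c hc, hY c a, mul_add, Finset.mul_sum]
    ring
  have hFs : ∑ c ∈ Finset.univ.filter (fun c => c ≠ a), F c =
      ∑ c ∈ Finset.univ.filter (fun c => c ≠ a), e c * Y a c -
      ∑ c ∈ Finset.univ.filter (fun c => c ≠ a), X a c := by
    rw [← Finset.sum_sub_distrib]
    exact Finset.sum_congr rfl fun c _ => hF c
  rw [hZs, hsw, hXs, hYs, hFs]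
  ring

/-- **Identity (q017)** for the reformulated elliptic Gaudin Hamiltonians. -/
theorem hamiltonian_identity_q017
    (τ : ℂ) (hτ : 0 < τ.im) (N : ℕ) (hN : 2 ≤ N)
    (n : ℕ) (z : Fin n → ℂ)
    (hz : ∀ a c : Fin n, a ≠ c → z a - z c ∉ latticeGamma τ)
    (a : Fin n)
    (S : Fin n → (ℤ × ℤ) → ℂ) :
    ((1 / (2 * (N : ℂ))) * (∑ c : Fin n, Matrix.trace (SmatC N S c * wpHatC N τ S c))
        - (1 / (2 * (N : ℂ))) * (∑ b : Fin n, ∑ c ∈ Finset.univ.filter (fun c => c ≠ b),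
            Matrix.trace (SmatC N S b * fHatC N τ S (z b - z c) c)))
      + (∑ c ∈ Finset.univ.filter (fun c => c ≠ a),
          E1 τ (z a - z c)
            * (-(1 / (N : ℂ)) * ∑ b ∈ Finset.univ.filter (fun b => b ≠ c),
                Matrix.trace (SmatC N S c * phiHatC N τ S (z c - z b) b)))
      = (1 / (2 * (N : ℂ))) * (∑ c : Fin n, Matrix.trace (SmatC N S c * wpHatC N τ S c))
          + (1 / (N : ℂ)) * (∑ c ∈ Finset.univ.filter (fun c => c ≠ a),
              Matrix.trace (SmatC N S a * FHatC N τ S (z a - z c) c))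
          + (1 / (2 * (N : ℂ)))
              * (∑ c ∈ Finset.univ.filter (fun c => c ≠ a),
                  ∑ b ∈ Finset.univ.filter (fun b => b ≠ a ∧ b ≠ c),
                    Matrix.trace (SmatC N S c * phiPhiHatC N τ z S a b c)) := by
  have hN0 : N ≠ 0 := by omega
  have hNC : (N : ℂ) ≠ 0 := by exact_mod_cast hN0
  have key := comb_identity a
    (fun b c => Matrix.trace (SmatC N S b * fHatC N τ S (z b - z c) c))
    (fun c b => Matrix.trace (SmatC N S c * phiHatC N τ S (z c - z b) b))
    (fun c b => Matrix.trace (SmatC N S c * phiPhiHatC N τ z S a b c))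
    (fun c => Matrix.trace (SmatC N S a * FHatC N τ S (z a - z c) c))
    (fun c => E1 τ (z a - z c)) ?_ ?_ ?_ ?_
  · have e1 : ∑ c ∈ Finset.univ.filter (fun c => c ≠ a),
          E1 τ (z a - z c)
            * (-(1 / (N : ℂ)) * ∑ b ∈ Finset.univ.filter (fun b => b ≠ c),
                Matrix.trace (SmatC N S c * phiHatC N τ S (z c - z b) b)) =
        -(1 / (N : ℂ)) * ∑ c ∈ Finset.univ.filter (fun c => c ≠ a),
          E1 τ (z a - z c) * ∑ b ∈ Finset.univ.filter (fun b => b ≠ c),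
                Matrix.trace (SmatC N S c * phiHatC N τ S (z c - z b) b) := by
      rw [Finset.mul_sum]
      refine Finset.sum_congr rfl fun c _ => ?_
      ring
    rw [e1]
    have e2 : (1 / (N : ℂ)) = 2 * (1 / (2 * (N : ℂ))) := by
      field_simp
    rw [e2]
    linear_combination (1 / (2 * (N : ℂ))) * key
  · intro b c
    refine Bf_symm hN0 S b c (g := fun γ => fG N τ γ (z b - z c))
      (h := fun γ => fG N τ γ (z c - z b)) ?_
    intro α β h1 h2
    have := fG_neg hτ hN0 h1 h2 (z c - z b)
    rwa [neg_sub] at this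
  · intro b c
    have h := Bf_symm hN0 S b c (g := fun γ => phiG N τ γ (z b - z c))
      (h := fun γ => 0 * phiG N τ γ (z c - z b) - phiG N τ γ (z c - z b)) (by
        intro α β h1 h2
        have := phiG_neg hτ hN0 h1 h2 (z c - z b)
        rw [neg_sub] at this
        rw [this]
        ring)
    rw [Bf_lin S c b 0 (fun γ _ => rfl), zero_mul, zero_sub] at h
    exact h
  · intro c
    refine Bf_lin S a c (g := fun γ => FG N τ γ (z a - z c))
      (g₁ := fun γ => phiG N τ γ (z a - z c)) (g₂ := fun γ => fG N τ γ (z a - z c)) _ ?_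
    intro γ _
    simp only [FG]
    ring
  · intro c b hc hb hbc
    have h := Bf_lin S c b (g := fun γ => phiG N τ γ (z a - z b) * phiG N τ γ (z c - z a))
      (g₁ := fun γ => phiG N τ γ (z c - z b)) (g₂ := fun γ => fG N τ γ (z c - z b))
      (E1 τ (z a - z b) - E1 τ (z a - z c)) (by
        intro γ hγ
        have h := phiG_fay hτ hγ (x := z a - z b) (y := z c - z a) (hz a b hb.symm) (hz c a hc)
          (by rw [show z a - z b + (z c - z a) = z c - z b by ring]; exact hz c b hbc.symm)
        rw [show z a - z b + (z c - z a) = z c - z b by ring, neg_sub] at h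
        rw [h]
        ring)
    simp only [Bf, ← mul_assoc] at h
    exact h

end
end

section
/- Rational Hamiltonian identity (q027) for the reformulated rational Gaudin model: Let N ≥ 2, let z_1,…,z_n ∈ ℂ be pairwise distinct, fix a ∈ {1,…,n}, and let S^1,…,S^n be N×N complex matrices. Define H_c = −(1/N) ∑_{b≠c} tr(S^c S^b)/(z_c − z_b) and η'^a = ∑_{c≠a} S^c/(z_a − z_c). Then ∑_{c≠a} H_c/(z_a − z_c) = −(1/2N) tr((η'^a)²) + (1/N) ∑_{c≠a} tr(S^a S^c)/(z_a − z_c)² + (1/2N) ∑_{c≠a} tr((S^c)²)/(z_a − z_c)². -/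
open scoped BigOperators
open Matrix Finset

noncomputable section

/-- **Rational Hamiltonian identity (q027)** for the reformulated rational Gaudin model. -/
theorem rational_hamiltonian_identity_q027
    (N : ℕ) (hN : 2 ≤ N) (n : ℕ)
    (z : Fin n → ℂ) (hz : ∀ a c : Fin n, a ≠ c → z a ≠ z c)
    (a : Fin n)
    (S : Fin n → Matrix (Fin N) (Fin N) ℂ) :
    (∑ c ∈ Finset.univ.filter (fun c => c ≠ a),
        (-(1 / (N : ℂ)) * ∑ b ∈ Finset.univ.filter (fun b => b ≠ c),
            Matrix.trace (S c * S b) / (z c - z b)) / (z a - z c))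
      = -(1 / (2 * (N : ℂ)))
            * Matrix.trace
                ((∑ c ∈ Finset.univ.filter (fun c => c ≠ a), (z a - z c)⁻¹ • S c)
                  * (∑ c ∈ Finset.univ.filter (fun c => c ≠ a), (z a - z c)⁻¹ • S c))
          + (1 / (N : ℂ)) * ∑ c ∈ Finset.univ.filter (fun c => c ≠ a),
              Matrix.trace (S a * S c) / (z a - z c) ^ 2
          + (1 / (2 * (N : ℂ))) * ∑ c ∈ Finset.univ.filter (fun c => c ≠ a),
              Matrix.trace (S c * S c) / (z a - z c) ^ 2 := by
  have hN0 : (N : ℂ) ≠ 0 := by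
    have : N ≠ 0 := by omega
    exact_mod_cast this
  set T := Finset.univ.filter (fun c : Fin n => c ≠ a) with hT
  have hne : ∀ c ∈ T, z a - z c ≠ 0 := by
    intro c hc
    have hca : c ≠ a := by simpa [hT] using hc
    exact sub_ne_zero.mpr (hz a c hca.symm)
  -- trace of the square
  have h1 : Matrix.trace ((∑ c ∈ T, (z a - z c)⁻¹ • S c) * (∑ c ∈ T, (z a - z c)⁻¹ • S c))
      = ∑ c ∈ T, ∑ b ∈ T, Matrix.trace (S c * S b) * ((z a - z c)⁻¹ * (z a - z b)⁻¹) := by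
    rw [Finset.sum_mul_sum, Matrix.trace_sum]
    refine Finset.sum_congr rfl fun c _ => ?_
    rw [Matrix.trace_sum]
    refine Finset.sum_congr rfl fun b _ => ?_
    rw [Matrix.smul_mul, Matrix.mul_smul, Matrix.trace_smul, Matrix.trace_smul]
    simp only [smul_eq_mul]
    ring
  -- splitting the inner sum
  have h2 : ∀ c, ∑ b ∈ Finset.univ.filter (fun b => b ≠ c),
      Matrix.trace (S c * S b) / (z c - z b)
      = Matrix.trace (S c * S a) / (z c - z a)
        + ∑ b ∈ T, Matrix.trace (S c * S b) / (z c - z b) := by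
    intro c
    have e1 : ∑ b ∈ Finset.univ.filter (fun b => b ≠ c),
        Matrix.trace (S c * S b) / (z c - z b)
        = ∑ b, Matrix.trace (S c * S b) / (z c - z b) := by
      apply Finset.sum_subset (Finset.filter_subset _ _)
      intro b _ hb
      have : b = c := by simpa using hb
      simp [this]
    rw [e1, hT, Finset.filter_ne']
    exact (Finset.add_sum_erase _ (fun b => Matrix.trace (S c * S b) / (z c - z b)) (Finset.mem_univ a)).symm
  -- symmetrization
  set D := ∑ c ∈ T, ∑ b ∈ T, Matrix.trace (S c * S b) / (z c - z b) / (z a - z c) with hD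
  have h3 : D + D = ∑ c ∈ T, ∑ b ∈ T, Matrix.trace (S c * S b) * ((z a - z c)⁻¹ * (z a - z b)⁻¹)
      - ∑ c ∈ T, Matrix.trace (S c * S c) / (z a - z c) ^ 2 := by
    have hDs : D = ∑ c ∈ T, ∑ b ∈ T, Matrix.trace (S b * S c) / (z b - z c) / (z a - z b) := by
      rw [hD, Finset.sum_comm]
    have hdiag : ∑ c ∈ T, Matrix.trace (S c * S c) / (z a - z c) ^ 2
        = ∑ c ∈ T, ∑ b ∈ T, if c = b then Matrix.trace (S c * S c) / (z a - z c) ^ 2 else 0 := by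
      refine Finset.sum_congr rfl fun c hc => ?_
      rw [Finset.sum_ite_eq, if_pos hc]
    nth_rewrite 2 [hDs]
    rw [hD, hdiag, ← Finset.sum_add_distrib, ← Finset.sum_sub_distrib]
    refine Finset.sum_congr rfl fun c hc => ?_
    rw [← Finset.sum_add_distrib, ← Finset.sum_sub_distrib]
    refine Finset.sum_congr rfl fun b hb => ?_
    have hc0 := hne c hc
    have hb0 := hne b hb
    by_cases hcb : c = b
    · subst hcb
      simp only [sub_self, div_zero, zero_div, add_zero, if_true]
      field_simp
      ring
    · have h0 : z c - z b ≠ 0 := sub_ne_zero.mpr (hz c b hcb)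
      rw [if_neg hcb, Matrix.trace_mul_comm (S b) (S c), ← neg_sub (z c) (z b)]
      field_simp
      ring
  have h4 : (∑ c ∈ T, (-(1 / (N : ℂ)) * ∑ b ∈ Finset.univ.filter (fun b => b ≠ c),
            Matrix.trace (S c * S b) / (z c - z b)) / (z a - z c))
      = (1 / (N : ℂ)) * ∑ c ∈ T, Matrix.trace (S a * S c) / (z a - z c) ^ 2
        - (1 / (N : ℂ)) * D := by
    rw [hD, Finset.mul_sum, Finset.mul_sum, ← Finset.sum_sub_distrib]
    refine Finset.sum_congr rfl fun c hc => ?_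
    have hc0 := hne c hc
    rw [h2, ← Finset.sum_div, Matrix.trace_mul_comm (S c) (S a), ← neg_sub (z a) (z c)]
    field_simp
    ring
  rw [h4, h1]
  have h5 : D = (∑ c ∈ T, ∑ b ∈ T, Matrix.trace (S c * S b) * ((z a - z c)⁻¹ * (z a - z b)⁻¹)
      - ∑ c ∈ T, Matrix.trace (S c * S c) / (z a - z c) ^ 2) / 2 := by
    rw [← h3]; ring
  rw [h5]
  field_simp
  ring

end
end

section
/- Zero-curvature representation of the rational 2-site first flow (principal chiral model, Section 3.2): Let N ≥ 2, let z₁ ≠ z₂ be complex numbers and k ∈ ℂ. Let S¹, S² : ℝ² → Mat_N(ℂ) be continuously differentiable matrix-valued functions of (x,t). Define L(x,t,z) = S¹/(z − z₁) + S²/(z − z₂) and M(x,t,z) = S¹/(z − z₁) − S²/(z − z₂). Then the zero-curvature equation ∂_t L − k ∂_x M = [L, M] holds for all (x,t) and all z ∈ ℂ ∖ {z₁, z₂}, if and only if for all (x,t): ∂_t S¹ − k ∂_x S¹ = −(2/(z₁ − z₂)) [S¹, S²] and ∂_t S² + k ∂_x S² = (2/(z₁ − z₂)) [S¹, S²]. 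-/
open scoped BigOperators
open Matrix

noncomputable section

/-- Entrywise partial derivative in the first (space) variable. -/
def mdx {N : ℕ} (S : ℝ → ℝ → Matrix (Fin N) (Fin N) ℂ) (x t : ℝ) :
    Matrix (Fin N) (Fin N) ℂ :=
  Matrix.of fun i j => deriv (fun x' => S x' t i j) x

/-- Entrywise partial derivative in the second (time) variable. -/
def mdt {N : ℕ} (S : ℝ → ℝ → Matrix (Fin N) (Fin N) ℂ) (x t : ℝ) :
    Matrix (Fin N) (Fin N) ℂ :=
  Matrix.of fun i j => deriv (fun t' => S x t' i j) t

theorem slice_x {f : ℝ × ℝ → ℂ} (h : ContDiff ℝ 1 f) (x t : ℝ) :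
    DifferentiableAt ℝ (fun x' => f (x', t)) x := by
  have h1 : Differentiable ℝ f := h.differentiable (by norm_num)
  exact (h1 (x, t)).comp x (by fun_prop : DifferentiableAt ℝ (fun x' : ℝ => (x', t)) x)

theorem slice_t {f : ℝ × ℝ → ℂ} (h : ContDiff ℝ 1 f) (x t : ℝ) :
    DifferentiableAt ℝ (fun t' => f (x, t')) t := by
  have h1 : Differentiable ℝ f := h.differentiable (by norm_num)
  exact (h1 (x, t)).comp t (by fun_prop : DifferentiableAt ℝ (fun t' : ℝ => (x, t')) t)

/-- **Section 3.2** (principal chiral model): the zero-curvature equation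
`∂_t L − k ∂_x M = [L, M]` for the rational 2-site Lax pair is equivalent to the
principal chiral model equations. -/
theorem rational_two_site_chiral_model
    (N : ℕ) (hN : 2 ≤ N) (z₁ z₂ : ℂ) (hz : z₁ ≠ z₂) (k : ℂ)
    (S1 S2 : ℝ → ℝ → Matrix (Fin N) (Fin N) ℂ)
    (hS1 : ∀ i j, ContDiff ℝ 1 (fun p : ℝ × ℝ => S1 p.1 p.2 i j))
    (hS2 : ∀ i j, ContDiff ℝ 1 (fun p : ℝ × ℝ => S2 p.1 p.2 i j)) :
    (∀ x t : ℝ, ∀ w : ℂ, w ≠ z₁ → w ≠ z₂ →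
        mdt (fun x' t' => (w - z₁)⁻¹ • S1 x' t' + (w - z₂)⁻¹ • S2 x' t') x t
          - k • mdx (fun x' t' => (w - z₁)⁻¹ • S1 x' t' - (w - z₂)⁻¹ • S2 x' t') x t
          = ((w - z₁)⁻¹ • S1 x t + (w - z₂)⁻¹ • S2 x t)
                * ((w - z₁)⁻¹ • S1 x t - (w - z₂)⁻¹ • S2 x t)
              - ((w - z₁)⁻¹ • S1 x t - (w - z₂)⁻¹ • S2 x t)
                * ((w - z₁)⁻¹ • S1 x t + (w - z₂)⁻¹ • S2 x t))
    ↔ (∀ x t : ℝ,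
        (mdt S1 x t - k • mdx S1 x t
            = -((2 / (z₁ - z₂)) • (S1 x t * S2 x t - S2 x t * S1 x t)))
          ∧ (mdt S2 x t + k • mdx S2 x t
            = (2 / (z₁ - z₂)) • (S1 x t * S2 x t - S2 x t * S1 x t))) := by
  have ht : ∀ (x t : ℝ) (a b : ℂ),
      mdt (fun x' t' => a • S1 x' t' + b • S2 x' t') x t = a • mdt S1 x t + b • mdt S2 x t := by
    intro x t a b
    ext i j
    have h1 := slice_t (hS1 i j) x t
    have h2 := slice_t (hS2 i j) x t
    simp only [mdt, Matrix.of_apply, Matrix.add_apply, Matrix.smul_apply, smul_eq_mul] at *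
    exact ((h1.hasDerivAt.const_mul a).add (h2.hasDerivAt.const_mul b)).deriv
  have hx : ∀ (x t : ℝ) (a b : ℂ),
      mdx (fun x' t' => a • S1 x' t' - b • S2 x' t') x t = a • mdx S1 x t - b • mdx S2 x t := by
    intro x t a b
    ext i j
    have h1 := slice_x (hS1 i j) x t
    have h2 := slice_x (hS2 i j) x t
    simp only [mdx, Matrix.of_apply, Matrix.sub_apply, Matrix.smul_apply, smul_eq_mul] at *
    exact ((h1.hasDerivAt.const_mul a).sub (h2.hasDerivAt.const_mul b)).deriv
  have hc : ∀ (A B : Matrix (Fin N) (Fin N) ℂ) (a b : ℂ),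
      (a • A + b • B) * (a • A - b • B) - (a • A - b • B) * (a • A + b • B)
        = (-(2 * (a * b))) • (A * B - B * A) := by
    intro A B a b
    simp only [mul_add, add_mul, mul_sub, sub_mul, smul_mul_assoc, mul_smul_comm]
    module
  simp only [ht, hx, hc]
  have hd : z₁ - z₂ ≠ 0 := sub_ne_zero.mpr hz
  refine forall_congr' fun x => forall_congr' fun t => ?_
  generalize S1 x t * S2 x t - S2 x t * S1 x t = C
  generalize mdt S1 x t = P
  generalize mdt S2 x t = Q
  generalize mdx S1 x t = U
  generalize mdx S2 x t = V
  constructor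
  · intro h
    have e1 := h (2 * z₁ - z₂) (fun e => hd (by linear_combination e))
      (fun e => hd (by linear_combination e / 2))
    have e2 := h (2 * z₂ - z₁) (fun e => hd (by linear_combination -e / 2))
      (fun e => hd (by linear_combination -e))
    rw [show 2 * z₁ - z₂ - z₁ = z₁ - z₂ by ring,
      show 2 * z₁ - z₂ - z₂ = 2 * (z₁ - z₂) by ring] at e1
    rw [show 2 * z₂ - z₁ - z₁ = -2 * (z₁ - z₂) by ring,
      show 2 * z₂ - z₁ - z₂ = -(z₁ - z₂) by ring] at e2
    generalize z₁ - z₂ = d at *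
    constructor
    all_goals
      ext i j
      have f1 := congrFun (congrFun e1 i) j
      have f2 := congrFun (congrFun e2 i) j
      simp only [Matrix.add_apply, Matrix.sub_apply, Matrix.neg_apply, Matrix.smul_apply,
        smul_eq_mul] at f1 f2 ⊢
      field_simp at f1 f2 ⊢
    · linear_combination (2 * f1 + f2) / 3
    · linear_combination -(2 * f2 + f1) / 3
  · rintro ⟨e1, e2⟩ w h1 h2
    have k1 : w - z₁ ≠ 0 := sub_ne_zero.mpr h1
    have k2 : w - z₂ ≠ 0 := sub_ne_zero.mpr h2
    have key : (w - z₁)⁻¹ * (2 / (z₁ - z₂)) - (w - z₂)⁻¹ * (2 / (z₁ - z₂))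
        = 2 * ((w - z₁)⁻¹ * (w - z₂)⁻¹) := by
      field_simp
      ring
    ext i j
    have f1 := congrFun (congrFun e1 i) j
    have f2 := congrFun (congrFun e2 i) j
    simp only [Matrix.add_apply, Matrix.sub_apply, Matrix.neg_apply, Matrix.smul_apply,
      smul_eq_mul] at f1 f2 ⊢
    linear_combination (w - z₁)⁻¹ * f1 + (w - z₂)⁻¹ * f2 - C i j * key

end
end
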